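/- Let G be a countable amenable group, X a compact metric space, Ω a singleton, and suppose the action of G on 𝓔 is minimal, i.e. the topological action G ↷ K on the nonempty compact set K ⊆ X determined by the trivial RDS is minimal. If the action G ↷ K is almost Weyl-mean equicontinuous, then G ↷ K is Weyl-mean equicontinuous. -/

import Mathlib

open Filter MeasureTheory Topology Metric Set ENNReal
open scoped symmDiff Classical

/-- `Φ` is a (left) Følner sequence of nonempty finite subsets of `G`. -/
def IsFolner {G : Type*} [Group G] (Φ : ℕ → Finset G) : Prop :=
  (∀ n, (Φ n).Nonempty) ∧
    ∀ g : G,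
      Tendsto (fun n => ((((Φ n).image fun t => g * t) ∆ Φ n).card : ℝ) / ((Φ n).card : ℝ))
        atTop (𝓝 0)

/-- The upper Banach density `BD*(E)` of a subset `E` of an amenable group `G`. -/
noncomputable def upperBanachDensity {G : Type*} [Group G] (E : Set G) : ℝ≥0∞ :=
  ⨆ (Φ : ℕ → Finset G) (_ : IsFolner Φ),
    Filter.limsup
      (fun n => (((Φ n).filter fun g => g ∈ E).card : ℝ≥0∞) / ((Φ n).card : ℝ≥0∞)) atTop

/-- A continuous bundle random dynamical system over the measure-preserving dynamical
system given by the measure-preserving action of `G` on the probability space `(Ω, μ)`,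
with fibers `E ω ⊆ X` and fiber maps `F g ω : E ω → E (g • ω)`. -/
structure RDS (G : Type*) [Group G] (Ω : Type*) [MeasurableSpace Ω] [MulAction G Ω]
    (μ : Measure Ω) (X : Type*) [MetricSpace X] [MeasurableSpace X] [BorelSpace X] where
  E : Ω → Set X
  F : G → Ω → X → X
  measurePreserving_smul : ∀ g : G, MeasurePreserving (fun ω : Ω => g • ω) μ μ
  measurableSet_carrier : MeasurableSet {p : Ω × X | p.2 ∈ E p.1}
  mapsTo : ∀ (g : G) (ω : Ω), Set.MapsTo (F g ω) (E ω) (E (g • ω))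
  one_apply : ∀ (ω : Ω), ∀ x ∈ E ω, F 1 ω x = x
  measurable_F : ∀ g : G, Measurable fun p : {p : Ω × X // p.2 ∈ E p.1} => F g p.1.1 p.1.2
  cocycle : ∀ (g₁ g₂ : G) (ω : Ω), ∀ x ∈ E ω, F g₂ (g₁ • ω) (F g₁ ω x) = F (g₂ * g₁) ω x
  ae_fiber : ∀ᵐ ω ∂μ, (E ω).Nonempty ∧ IsCompact (E ω) ∧ ∀ g : G, ContinuousOn (F g ω) (E ω)

namespace RDS

variable {G : Type*} [Group G] {Ω : Type*} [MeasurableSpace Ω] [MulAction G Ω]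
  {μ : Measure Ω} {X : Type*} [MetricSpace X] [MeasurableSpace X] [BorelSpace X]
  (S : RDS G Ω μ X)

/-- The carrier `𝓔 ⊆ Ω × X` of the RDS. -/
def carrier : Set (Ω × X) := {p : Ω × X | p.2 ∈ S.E p.1}

/-- `d̃(tx, ty) := sup_ω d(F_{t,ω} x, F_{t,ω} y)` when `x, y` lie in a common fiber,
and `∞` otherwise. -/
noncomputable def dt (t : G) (x y : X) : ℝ≥0∞ :=
  if ∃ ω : Ω, x ∈ S.E ω ∧ y ∈ S.E ω then
    ⨆ ω ∈ {ω : Ω | x ∈ S.E ω ∧ y ∈ S.E ω}, edist (S.F t ω x) (S.F t ω y)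
  else ⊤

/-- `D^{(r)}_𝓕(x,y) := limsup_n (1/|Φ n|) Σ_{t ∈ Φ n} d̃(tx,ty)`. -/
noncomputable def DFol (Φ : ℕ → Finset G) (x y : X) : ℝ≥0∞ :=
  Filter.limsup (fun n => (∑ t ∈ Φ n, S.dt t x y) / ((Φ n).card : ℝ≥0∞)) atTop

/-- The Weyl pseudometric `D^{(r)}(x,y)`, the sup over all Følner sequences. -/
noncomputable def DW (x y : X) : ℝ≥0∞ :=
  ⨆ (Φ : ℕ → Finset G) (_ : IsFolner Φ), S.DFol Φ x y

/-- The Banach pseudometric `D̄^{(r)}(x,y) := inf_K sup_g (1/|K|) Σ_{t ∈ Kg} d̃(tx,ty)`. -/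
noncomputable def DB (x y : X) : ℝ≥0∞ :=
  ⨅ (K : Finset G) (_ : K.Nonempty),
    ⨆ g : G, (∑ t ∈ K.image fun k => k * g, S.dt t x y) / ((K.card : ℝ≥0∞))

/-- Weyl-mean equicontinuity of the RDS. -/
def WME : Prop :=
  ∀ ε : ℝ, 0 < ε → ∃ δ : ℝ, 0 < δ ∧ ∀ (ω : Ω) (x y : X),
    x ∈ S.E ω → y ∈ S.E ω → dist x y < δ → S.DW x y < ENNReal.ofReal ε

/-- Banach-mean equicontinuity of the RDS. -/
def BME : Prop :=
  ∀ ε : ℝ, 0 < ε → ∃ δ : ℝ, 0 < δ ∧ ∀ (ω : Ω) (x y : X),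
    x ∈ S.E ω → y ∈ S.E ω → dist x y < δ → S.DB x y < ENNReal.ofReal ε

/-- Mean-L-stability: points starting close stay `ε`-close outside a set of
upper Banach density less than `ε`. -/
def MeanLStable : Prop :=
  ∀ ε : ℝ, 0 < ε → ∃ δ : ℝ, 0 < δ ∧ ∀ (ω : Ω) (x y : X),
    x ∈ S.E ω → y ∈ S.E ω → dist x y < δ →
      upperBanachDensity {g : G | ENNReal.ofReal ε ≤ S.dt g x y} < ENNReal.ofReal ε

/-- `Ĥ^{(r)}_{𝓕,ω}(x,y)`. -/
noncomputable def HFol (Φ : ℕ → Finset G) (ω : Ω) (x y : X) : ℝ≥0∞ :=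
  if x ∈ S.E ω ∧ y ∈ S.E ω then
    Filter.limsup
      (fun n => (∑ t ∈ Φ n, edist (S.F t ω x) (S.F t ω y)) / ((Φ n).card : ℝ≥0∞)) atTop
  else ⊤

/-- `Ĥ^{(r)}_ω(x,y)`, the sup over all Følner sequences of `Ĥ^{(r)}_{𝓕,ω}(x,y)`. -/
noncomputable def HW (ω : Ω) (x y : X) : ℝ≥0∞ :=
  ⨆ (Φ : ℕ → Finset G) (_ : IsFolner Φ), S.HFol Φ ω x y

/-- `Ĥ^{(r)}(x,y) := sup_ω Ĥ^{(r)}_ω(x,y)`. -/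
noncomputable def Hsup (x y : X) : ℝ≥0∞ := ⨆ ω : Ω, S.HW ω x y

/-- Weyl-mean sensitivity of the RDS. -/
def WeylMeanSensitive : Prop :=
  ∃ δ : ℝ, 0 < δ ∧ ∀ (x : X) (ε : ℝ), 0 < ε →
    ∃ (ω : Ω) (y : X), y ∈ S.E ω ∩ Metric.ball x ε ∧ ENNReal.ofReal δ < S.HW ω x y

/-- The set `𝔼_{ω,ε}` of points of `E ω` around which the Weyl pseudometric is
uniformly `< ε` on a small relative ball. -/
def EE (ω : Ω) (ε : ℝ) : Set X :=
  {x ∈ S.E ω | ∃ δ : ℝ, 0 < δ ∧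
    ∀ y ∈ Metric.ball x δ ∩ S.E ω, ∀ z ∈ Metric.ball x δ ∩ S.E ω,
      S.DW y z < ENNReal.ofReal ε}

/-- The set `𝔼` of Weyl-mean equicontinuous points of the RDS. -/
def meanEqPts : Set X :=
  {x : X | ∀ ε : ℝ, 0 < ε → ∃ δ : ℝ, 0 < δ ∧ ∀ (ω : Ω) (y : X),
    y ∈ S.E ω → dist x y < δ → S.DW x y < ENNReal.ofReal ε}

end RDS

/-- `D_𝓕(x,y)` for a (deterministic) group action `T` of `G` on `K`. -/
noncomputable def actDFol {G K : Type*} [Group G] [PseudoMetricSpace K]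
    (T : G → K → K) (Φ : ℕ → Finset G) (x y : K) : ℝ≥0∞ :=
  Filter.limsup (fun n => (∑ t ∈ Φ n, edist (T t x) (T t y)) / ((Φ n).card : ℝ≥0∞)) atTop

/-- The Weyl pseudometric `D(x,y)` for a group action. -/
noncomputable def actDW {G K : Type*} [Group G] [PseudoMetricSpace K]
    (T : G → K → K) (x y : K) : ℝ≥0∞ :=
  ⨆ (Φ : ℕ → Finset G) (_ : IsFolner Φ), actDFol T Φ x y

/-- The Banach pseudometric `D̄(x,y)` for a group action. -/
noncomputable def actDB {G K : Type*} [Group G] [PseudoMetricSpace K]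
    (T : G → K → K) (x y : K) : ℝ≥0∞ :=
  ⨅ (F : Finset G) (_ : F.Nonempty),
    ⨆ g : G, (∑ t ∈ F.image fun k => k * g, edist (T t x) (T t y)) / ((F.card : ℝ≥0∞))

/-- The set of Weyl-mean equicontinuous points of a group action. -/
def actMeanEqPts {G K : Type*} [Group G] [PseudoMetricSpace K]
    (T : G → K → K) : Set K :=
  {x : K | ∀ ε : ℝ, 0 < ε → ∃ δ : ℝ, 0 < δ ∧
    ∀ y : K, dist x y < δ → actDW T x y < ENNReal.ofReal ε}

/-- Subadditivity of `limsup` in `ℝ≥0∞` along an arbitrary filter. -/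
theorem ENNReal.limsup_add_le_limsup_add_limsup {ι : Type*} (f : Filter ι) (u v : ι → ℝ≥0∞) :
    limsup (fun i => u i + v i) f ≤ limsup u f + limsup v f := by
  refine ENNReal.le_of_forall_pos_le_add fun ε hε hfin => ?_
  obtain ⟨hu, hv⟩ := ENNReal.add_lt_top.1 hfin
  have hε' : (ε / 2 : ℝ≥0∞) ≠ 0 := (ENNReal.half_pos (by exact_mod_cast hε.ne')).ne'
  have hu' := eventually_lt_of_limsup_lt (ENNReal.lt_add_right hu.ne hε')
  have hv' := eventually_lt_of_limsup_lt (ENNReal.lt_add_right hv.ne hε')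
  refine limsup_le_of_le (h := ?_)
  filter_upwards [hu', hv'] with i hi hi'
  refine (add_le_add hi.le hi'.le).trans_eq ?_
  rw [add_add_add_comm, ENNReal.add_halves]

section WeylPseudometric

variable {G : Type*} [Group G] {K : Type*} [PseudoMetricSpace K] (T : G → K → K)

/-- Right translates of a left Følner sequence are left Følner. -/
theorem IsFolner.image_mul_right {Φ : ℕ → Finset G} (hΦ : IsFolner Φ) (h : G) :
    IsFolner fun n => (Φ n).image fun t => t * h := by
  have hinj : Function.Injective fun t : G => t * h := mul_left_injective h
  refine ⟨fun n => (hΦ.1 n).image _, fun g => ?_⟩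
  refine (hΦ.2 g).congr fun n => ?_
  have hcomm : (((Φ n).image fun t => t * h).image fun t => g * t) =
      ((Φ n).image fun t => g * t).image fun t => t * h := by
    simp only [Finset.image_image, Function.comp_def, mul_assoc]
  rw [hcomm, ← Finset.image_symmDiff _ _ hinj, Finset.card_image_of_injective _ hinj,
    Finset.card_image_of_injective _ hinj]

theorem actDFol_apply_apply (hTmul : ∀ (g₁ g₂ : G) (x : K), T g₂ (T g₁ x) = T (g₂ * g₁) x)
    (Φ : ℕ → Finset G) (h : G) (x y : K) :
    actDFol T Φ (T h x) (T h y) = actDFol T (fun n => (Φ n).image fun t => t * h) x y := by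
  have hinj : Function.Injective fun t : G => t * h := mul_left_injective h
  simp only [actDFol, hTmul, Finset.card_image_of_injective _ hinj,
    Finset.sum_image hinj.injOn]

theorem actDW_apply_apply_le (hTmul : ∀ (g₁ g₂ : G) (x : K), T g₂ (T g₁ x) = T (g₂ * g₁) x)
    (h : G) (x y : K) : actDW T (T h x) (T h y) ≤ actDW T x y := by
  refine iSup₂_le fun Φ hΦ => ?_
  rw [actDFol_apply_apply T hTmul]
  exact le_iSup₂_of_le _ (hΦ.image_mul_right h) le_rfl

/-- The Weyl pseudometric of an action is invariant under the action. -/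
theorem actDW_apply_apply (hT1 : ∀ x : K, T 1 x = x)
    (hTmul : ∀ (g₁ g₂ : G) (x : K), T g₂ (T g₁ x) = T (g₂ * g₁) x)
    (h : G) (x y : K) : actDW T (T h x) (T h y) = actDW T x y := by
  refine le_antisymm (actDW_apply_apply_le T hTmul h x y) ?_
  simpa only [hTmul, inv_mul_cancel, hT1] using
    actDW_apply_apply_le T hTmul h⁻¹ (T h x) (T h y)

theorem actDW_comm (x y : K) : actDW T x y = actDW T y x := by
  simp only [actDW, actDFol, edist_comm]

theorem actDW_triangle (x y z : K) : actDW T x z ≤ actDW T x y + actDW T y z := by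
  refine iSup₂_le fun Φ hΦ => ?_
  calc actDFol T Φ x z ≤ actDFol T Φ x y + actDFol T Φ y z := by
        refine le_trans (limsup_le_limsup (Eventually.of_forall fun n => ?_))
          (ENNReal.limsup_add_le_limsup_add_limsup _ _ _)
        rw [← ENNReal.add_div, ← Finset.sum_add_distrib]
        exact ENNReal.div_le_div_right
          (Finset.sum_le_sum fun t _ => edist_triangle _ (T t y) _) _
    _ ≤ _ := add_le_add (le_iSup₂_of_le Φ hΦ le_rfl) (le_iSup₂_of_le Φ hΦ le_rfl)

/-- Every orbit of a minimal action is dense. -/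
theorem denseRange_orbit_of_minimal
    (hTmul : ∀ (g₁ g₂ : G) (x : K), T g₂ (T g₁ x) = T (g₂ * g₁) x)
    (hTc : ∀ g : G, Continuous (T g))
    (hmin : ∀ C : Set K, IsClosed C → (∀ g : G, T g '' C ⊆ C) → C = ∅ ∨ C = Set.univ)
    (x : K) : DenseRange fun g => T g x := by
  refine dense_iff_closure_eq.2 ((hmin _ isClosed_closure fun g => ?_).resolve_left ?_)
  · refine (image_closure_subset_closure_image (hTc g)).trans (closure_mono ?_)
    rintro _ ⟨_, ⟨h, rfl⟩, rfl⟩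
    exact ⟨g * h, (hTmul h g x).symm⟩
  · exact ((range_nonempty _).closure).ne_empty

end WeylPseudometric

/-- A minimal, almost Weyl-mean equicontinuous action of a countable
amenable group on a nonempty compact metric space is Weyl-mean equicontinuous. -/
theorem minimal_almost_wme_implies_wme
    {G : Type*} [Group G] [Countable G]
    {K : Type*} [MetricSpace K] [CompactSpace K] [Nonempty K]
    (hG : ∃ Φ : ℕ → Finset G, IsFolner Φ)
    (T : G → K → K)
    (hT1 : ∀ x : K, T 1 x = x)
    (hTmul : ∀ (g₁ g₂ : G) (x : K), T g₂ (T g₁ x) = T (g₂ * g₁) x)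
    (hTc : ∀ g : G, Continuous (T g))
    (hmin : ∀ C : Set K, IsClosed C → (∀ g : G, T g '' C ⊆ C) → C = ∅ ∨ C = Set.univ)
    (halmost : (actMeanEqPts T).Nonempty) :
    ∀ ε : ℝ, 0 < ε → ∃ δ : ℝ, 0 < δ ∧
      ∀ x y : K, dist x y < δ → actDW T x y < ENNReal.ofReal ε := by
  intro ε hε
  obtain ⟨x₀, hx₀⟩ := halmost
  obtain ⟨r, hr, hball⟩ := hx₀ (ε / 2) (half_pos hε)
  have hcover : (Set.univ : Set K) ⊆ ⋃ g : G, T g ⁻¹' ball x₀ r := fun y _ => by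
    obtain ⟨g, hg⟩ := (denseRange_orbit_of_minimal T hTmul hTc hmin y).exists_mem_open
      isOpen_ball ⟨x₀, mem_ball_self hr⟩
    exact mem_iUnion.2 ⟨g, hg⟩
  obtain ⟨δ, hδ, hleb⟩ := lebesgue_number_lemma_of_metric isCompact_univ
    (fun g => isOpen_ball.preimage (hTc g)) hcover
  refine ⟨δ, hδ, fun x y hxy => ?_⟩
  obtain ⟨g, hg⟩ := hleb x (mem_univ x)
  have hx : dist x₀ (T g x) < r := mem_ball'.1 (hg (mem_ball_self hδ))
  have hy : dist x₀ (T g y) < r := mem_ball'.1 (hg (mem_ball'.2 hxy))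
  calc actDW T x y = actDW T (T g x) (T g y) := (actDW_apply_apply T hT1 hTmul g x y).symm
    _ ≤ actDW T (T g x) x₀ + actDW T x₀ (T g y) := actDW_triangle T _ _ _
    _ < ENNReal.ofReal (ε / 2) + ENNReal.ofReal (ε / 2) := by
        rw [actDW_comm T _ x₀]
        exact ENNReal.add_lt_add (hball _ hx) (hball _ hy)
    _ = ENNReal.ofReal ε := by
        rw [← ENNReal.ofReal_add (half_pos hε).le (half_pos hε).le, add_halves]
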